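/- Let h_1, ..., h_N be nonzero linear functionals on ℝ^d and a_1, ..., a_N real numbers, and let A be the hyperplane arrangement consisting of the affine hyperplanes H_i = {x ∈ ℝ^d : h_i(x) = a_i}. Fix any linear order ρ on {1,...,N}. Then the number of regions of A equals the number of subsets I ⊆ {1,...,N} such that rk(I) = |I| and I contains no broken central circuit; here rk(I) is the dimension of the linear span of {h_i : i ∈ I}, a subset C is a central cycle if rk(C) = |C| − 1, every proper subset J ⊊ C satisfies rk(J) = |J|, and ⋂_{i∈C} H_i ≠ ∅, and a subset J is a broken central circuit if there exists i ∉ J such that J ∪ {i} is a central cycle and i is the minimal element of J ∪ {i} with respect to ρ. -/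

import Mathlib

/-- The number of regions of the complement of an arrangement. -/
noncomputable def numRegions {V : Type*} [TopologicalSpace V] (s : Set V) : ℕ :=
  Nat.card (ConnectedComponents s)

/-- The rank of a subset `I` of the hyperplanes: the dimension of the linear span of
the corresponding linear functionals. -/
noncomputable def rk {d N : ℕ} (h : Fin N → ((Fin d → ℝ) →ₗ[ℝ] ℝ))
    (I : Finset (Fin N)) : ℕ :=
  Module.finrank ℝ (Submodule.span ℝ (h '' ↑I))

/-- A subset `I` is central if the intersection of the corresponding hyperplanes is
nonempty. -/
def IsCentral {d N : ℕ} (h : Fin N → ((Fin d → ℝ) →ₗ[ℝ] ℝ)) (a : Fin N → ℝ)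
    (I : Finset (Fin N)) : Prop :=
  (⋂ i ∈ I, {x : Fin d → ℝ | h i x = a i}).Nonempty

/-- A central cycle: `rk C = |C| - 1`, every proper subset is independent, and `C` is
central. -/
def IsCentralCycle {d N : ℕ} (h : Fin N → ((Fin d → ℝ) →ₗ[ℝ] ℝ)) (a : Fin N → ℝ)
    (C : Finset (Fin N)) : Prop :=
  (rk h C : ℤ) = (C.card : ℤ) - 1 ∧ (∀ J ⊂ C, rk h J = J.card) ∧ IsCentral h a C

/-- A broken central circuit with respect to the linear order `ρ`: a set `J` such that
for some `i ∉ J`, `J ∪ {i}` is a central cycle and `i` is its `ρ`-minimal element. -/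
def IsBrokenCentralCircuit {d N : ℕ} (h : Fin N → ((Fin d → ℝ) →ₗ[ℝ] ℝ)) (a : Fin N → ℝ)
    (ρ : LinearOrder (Fin N)) (J : Finset (Fin N)) : Prop :=
  ∃ i ∉ J, IsCentralCycle h a (insert i J) ∧ ∀ j ∈ insert i J, ρ.le i j

open Module Submodule Filter Topology

/-- The point `x` lies in the half-space `0 < ℓ` and, among the hyperplanes indexed by `s`,
exactly those indexed by `T` have `x` on their positive side. -/
def InCell {ι W : Type*} [AddCommGroup W] [Module ℝ W] (ℓ : Dual ℝ W) (g : ι → Dual ℝ W)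
    (s T : Finset ι) (x : W) : Prop :=
  0 < ℓ x ∧ ∀ i ∈ s, (i ∈ T → 0 < g i x) ∧ (i ∉ T → g i x < 0)

/-- No functional `g i` with `i ∈ s` lies in the span of the later members of `I`, and `ℓ` does
not lie in the span of `I`. -/
def IsNBC {ι W : Type*} [LinearOrder ι] [AddCommGroup W] [Module ℝ W] (ℓ : Dual ℝ W)
    (g : ι → Dual ℝ W) (s I : Finset ι) : Prop :=
  ℓ ∉ span ℝ (g '' (I : Set ι)) ∧ ∀ i ∈ s, g i ∉ span ℝ (g '' {j | j ∈ I ∧ i < j})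

theorem ncard_subsets_insert {ι : Type*} [DecidableEq ι] {n : ι} {s : Finset ι} (hn : n ∉ s)
    (P : Finset ι → Prop) :
    {T | T ⊆ insert n s ∧ P T}.ncard =
      {T | T ⊆ s ∧ P T}.ncard + {T | T ⊆ s ∧ P (insert n T)}.ncard := by
  have hfin (Q : Finset ι → Prop) : {T | T ⊆ s ∧ Q T}.Finite :=
    (Finset.finite_toSet s.powerset).subset fun T hT => by simpa using hT.1
  have hsplit : {T | T ⊆ insert n s ∧ P T} =
      {T | T ⊆ s ∧ P T} ∪ insert n '' {T | T ⊆ s ∧ P (insert n T)} := by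
    ext T
    constructor
    · rintro ⟨hT, hP⟩
      by_cases hnT : n ∈ T
      · refine Or.inr ⟨T.erase n, ⟨?_, ?_⟩, Finset.insert_erase hnT⟩
        · rwa [← Finset.subset_insert_iff]
        · rwa [Finset.insert_erase hnT]
      · exact Or.inl ⟨(Finset.subset_insert_iff_of_notMem hnT).1 hT, hP⟩
    · rintro (⟨hT, hP⟩ | ⟨T, ⟨hT, hP⟩, rfl⟩)
      · exact ⟨hT.trans (Finset.subset_insert _ _), hP⟩
      · exact ⟨Finset.insert_subset_insert _ hT, hP⟩
  rw [hsplit, Set.ncard_union_eq _ (hfin _) ((hfin _).image _), Set.InjOn.ncard_image]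
  · intro T hT T' hT' h
    have h1 : n ∉ T := fun h => hn (hT.1 h)
    have h2 : n ∉ T' := fun h => hn (hT'.1 h)
    rw [← Finset.erase_insert h1, ← Finset.erase_insert h2, h]
  · rw [Set.disjoint_left]
    rintro T hT ⟨T', -, rfl⟩
    exact hn (hT.1 (Finset.mem_insert_self _ _))

section Recurrence

variable {ι W : Type*} [AddCommGroup W] [Module ℝ W] {ℓ : Dual ℝ W} {g : ι → Dual ℝ W}
  {s T : Finset ι}

theorem InCell.eventually_add_smul {x : W} (hx : InCell ℓ g s T x) (v : W) :
    ∀ᶠ δ in 𝓝 (0 : ℝ), InCell ℓ g s T (x + δ • v) := by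
  have hpos (f : Dual ℝ W) (hf : 0 < f x) : ∀ᶠ δ in 𝓝 (0 : ℝ), 0 < f (x + δ • v) := by
    have hc : Continuous fun δ : ℝ => f (x + δ • v) := by
      simp only [map_add, map_smul, smul_eq_mul]
      fun_prop
    exact hc.continuousAt.eventually (lt_mem_nhds (by simpa using hf))
  refine (hpos ℓ hx.1).and ((eventually_all_finset s).2 fun i hi => ?_)
  by_cases hiT : i ∈ T
  · simpa [hiT] using hpos _ ((hx.2 i hi).1 hiT)
  · have := hpos (-g i) (by simpa using (hx.2 i hi).2 hiT)
    simpa only [hiT, false_imp_iff, true_and, not_false_eq_true, true_imp_iff,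
      LinearMap.neg_apply, neg_pos] using this

theorem InCell.exists_pos {x : W} (hx : InCell ℓ g s T x) {f : Dual ℝ W} (hf : f ≠ 0)
    (h0 : 0 ≤ f x) : ∃ y, InCell ℓ g s T y ∧ 0 < f y := by
  obtain ⟨v, hv⟩ : ∃ v, 0 < f v := by
    obtain ⟨v, hv⟩ := DFunLike.ne_iff.1 hf
    rcases lt_or_gt_of_ne hv with hv | hv
    · exact ⟨-v, by simpa using hv⟩
    · exact ⟨v, hv⟩
  have h1 : ∀ᶠ δ in 𝓝[>] (0 : ℝ), InCell ℓ g s T (x + δ • v) :=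
    (hx.eventually_add_smul v).filter_mono nhdsWithin_le_nhds
  obtain ⟨δ, hδ, hpos⟩ := (h1.and self_mem_nhdsWithin).exists
  refine ⟨_, hδ, ?_⟩
  have : 0 < δ * f v := mul_pos hpos hv
  simp only [map_add, map_smul, smul_eq_mul]
  linarith

theorem InCell.exists_neg {x : W} (hx : InCell ℓ g s T x) {f : Dual ℝ W} (hf : f ≠ 0)
    (h0 : f x ≤ 0) : ∃ y, InCell ℓ g s T y ∧ f y < 0 := by
  simpa using hx.exists_pos (f := -f) (neg_ne_zero.2 hf) (by simpa using h0)

theorem convex_inCell : Convex ℝ {x | InCell ℓ g s T x} := by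
  have hset : {x | InCell ℓ g s T x} =
      {x | 0 < ℓ x} ∩ ⋂ i ∈ s, ({x | i ∈ T → 0 < g i x} ∩ {x | i ∉ T → g i x < 0}) := by
    ext x
    simp [InCell]
  rw [hset]
  refine (convex_halfSpace_gt ℓ.isLinear 0).inter (convex_iInter₂ fun i _ => ?_)
  by_cases hi : i ∈ T
  · simpa [hi] using convex_halfSpace_gt (g i).isLinear 0
  · simpa [hi] using convex_halfSpace_lt (g i).isLinear 0

theorem exists_inCell_eq_zero {f : Dual ℝ W} {x y : W} (hx : InCell ℓ g s T x) (hfx : f x < 0)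
    (hy : InCell ℓ g s T y) (hfy : 0 < f y) : ∃ z, InCell ℓ g s T z ∧ f z = 0 := by
  have hd : 0 < f y - f x := by linarith
  refine ⟨(f y / (f y - f x)) • x + (-f x / (f y - f x)) • y, ?_, ?_⟩
  · refine convex_inCell hx hy (by positivity) (div_nonneg (by linarith) hd.le) ?_
    field_simp
    ring
  · simp only [map_add, map_smul, smul_eq_mul]
    field_simp
    ring

theorem inCell_insert_of_notMem [DecidableEq ι] {n : ι} (hn : n ∉ T) {x : W} :
    InCell ℓ g (insert n s) T x ↔ InCell ℓ g s T x ∧ g n x < 0 := by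
  simp only [InCell, Finset.forall_mem_insert, hn]
  tauto

theorem inCell_insert_insert [DecidableEq ι] {n : ι} (hn : n ∉ s) {x : W} :
    InCell ℓ g (insert n s) (insert n T) x ↔ InCell ℓ g s T x ∧ 0 < g n x := by
  have h (i) (hi : i ∈ s) : i ∈ insert n T ↔ i ∈ T := by
    simp [show i ≠ n by rintro rfl; exact hn hi]
  simp only [InCell, Finset.forall_mem_insert]
  rw [forall₂_congr fun i hi => by rw [h i hi]]
  simp
  tauto

theorem ncard_cells_insert [DecidableEq ι] {n : ι} (hn : n ∉ s) (hg : g n ≠ 0) :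
    {T | T ⊆ insert n s ∧ ∃ x, InCell ℓ g (insert n s) T x}.ncard =
      {T | T ⊆ s ∧ ∃ x, InCell ℓ g s T x}.ncard +
      {T | T ⊆ s ∧ ∃ x, InCell ((g n).ker.subtype.dualMap ℓ)
        (fun i => (g n).ker.subtype.dualMap (g i)) s T x}.ncard := by
  have hfin (Q : Finset ι → Prop) : {T | T ⊆ s ∧ Q T}.Finite :=
    (Finset.finite_toSet s.powerset).subset fun T hT => by simpa using hT.1
  rw [ncard_subsets_insert hn, ← Set.ncard_union_add_ncard_inter _ _ (hfin _) (hfin _)]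
  congr 2
  · ext T
    constructor
    · rintro (⟨hT, x, hx⟩ | ⟨hT, x, hx⟩)
      · exact ⟨hT, x, ((inCell_insert_of_notMem fun h => hn (hT h)).1 hx).1⟩
      · exact ⟨hT, x, ((inCell_insert_insert hn).1 hx).1⟩
    · rintro ⟨hT, x, hx⟩
      rcases le_total 0 (g n x) with h0 | h0
      · obtain ⟨y, hy⟩ := hx.exists_pos hg h0
        exact Or.inr ⟨hT, y, (inCell_insert_insert hn).2 hy⟩
      · obtain ⟨y, hy⟩ := hx.exists_neg hg h0
        exact Or.inl ⟨hT, y, (inCell_insert_of_notMem fun h => hn (hT h)).2 hy⟩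
  · ext T
    constructor
    · rintro ⟨⟨hT, x, hx⟩, -, y, hy⟩
      rw [inCell_insert_of_notMem fun h => hn (hT h)] at hx
      rw [inCell_insert_insert hn] at hy
      obtain ⟨z, hz, hz0⟩ := exists_inCell_eq_zero hx.1 hx.2 hy.1 hy.2
      exact ⟨hT, ⟨z, hz0⟩, hz⟩
    · rintro ⟨hT, ⟨x, hx0⟩, hx⟩
      replace hx : InCell ℓ g s T x := hx
      rw [LinearMap.mem_ker] at hx0
      obtain ⟨y, hy⟩ := hx.exists_neg hg hx0.le
      obtain ⟨z, hz⟩ := hx.exists_pos hg hx0.ge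
      exact ⟨⟨hT, y, (inCell_insert_of_notMem fun h => hn (hT h)).2 hy⟩,
        ⟨hT, z, (inCell_insert_insert hn).2 hz⟩⟩

theorem mem_span_dualMap_ker (f f₀ : Dual ℝ W) (S : Set ι) :
    f₀.ker.subtype.dualMap f ∈ span ℝ ((fun i => f₀.ker.subtype.dualMap (g i)) '' S) ↔
      f ∈ span ℝ (insert f₀ (g '' S)) := by
  have hker : f₀.ker.subtype.dualMap.ker = span ℝ {f₀} := by
    ext φ
    constructor
    · intro hφ
      have := mem_span_of_iInf_ker_le_ker (L := fun _ : Unit => f₀) (K := φ) fun x hx => by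
        rw [iInf_const] at hx
        exact LinearMap.congr_fun hφ ⟨x, hx⟩
      simpa using this
    · intro hφ
      obtain ⟨c, rfl⟩ := mem_span_singleton.1 hφ
      ext x
      simp
  rw [show (fun i => f₀.ker.subtype.dualMap (g i)) '' S = f₀.ker.subtype.dualMap '' (g '' S) by
    rw [Set.image_image], span_image, ← Submodule.mem_comap, comap_map_eq, hker,
    span_insert, sup_comm]

end Recurrence

theorem ncard_nbc_insert {ι W : Type*} [LinearOrder ι] [AddCommGroup W] [Module ℝ W]
    {ℓ : Dual ℝ W} {g : ι → Dual ℝ W} {s : Finset ι} {n : ι} (hn : ∀ i ∈ s, i < n)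
    (hg : g n ≠ 0) :
    {I | I ⊆ insert n s ∧ IsNBC ℓ g (insert n s) I}.ncard =
      {I | I ⊆ s ∧ IsNBC ℓ g s I}.ncard +
      {I | I ⊆ s ∧ IsNBC ((g n).ker.subtype.dualMap ℓ)
        (fun i => (g n).ker.subtype.dualMap (g i)) s I}.ncard := by
  have hns : n ∉ s := fun h => (hn n h).false
  rw [ncard_subsets_insert hns]
  congr 2
  · ext I
    refine and_congr_right fun hI => ?_
    have hempty : {j | j ∈ I ∧ n < j} = ∅ :=
      Set.eq_empty_of_forall_notMem fun j hj => (hj.2.trans (hn j (hI hj.1))).false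
    simp [IsNBC, hempty, hg]
  · ext I
    refine and_congr_right fun hI => ?_
    have hempty : {j | j ∈ insert n I ∧ n < j} = ∅ := by
      refine Set.eq_empty_of_forall_notMem fun j hj => ?_
      rcases Finset.mem_insert.1 hj.1 with rfl | h
      · exact hj.2.false
      · exact (hj.2.trans (hn j (hI h))).false
    have hset (i) (hi : i ∈ s) :
        {j | j ∈ insert n I ∧ i < j} = insert n {j | j ∈ I ∧ i < j} := by
      ext j
      have := hn i hi
      simp only [Finset.mem_insert, Set.mem_ofPred_eq, Set.mem_insert_iff]
      constructor
      · tauto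
      · rintro (rfl | h) <;> tauto
    simp only [IsNBC, Finset.forall_mem_insert, hempty, mem_span_dualMap_ker]
    rw [forall₂_congr fun i hi => by rw [hset i hi]]
    simp [hg, Set.image_insert_eq]

theorem ncard_cells_eq_ncard_nbc {ι : Type*} [LinearOrder ι] {W : Type*} [AddCommGroup W]
    [Module ℝ W] (ℓ : Dual ℝ W) (g : ι → Dual ℝ W) (s : Finset ι) :
    {T | T ⊆ s ∧ ∃ x, InCell ℓ g s T x}.ncard = {I | I ⊆ s ∧ IsNBC ℓ g s I}.ncard := by
  induction s using Finset.induction_on_max generalizing W with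
  | empty =>
    congr 1
    ext T
    refine and_congr_right fun hT => ?_
    rw [Finset.subset_empty.1 hT]
    simp only [InCell, IsNBC, Finset.notMem_empty, false_imp_iff, implies_true, and_true,
      Finset.coe_empty, Set.image_empty, span_empty, Submodule.mem_bot]
    constructor
    · rintro ⟨x, hx⟩ rfl
      simp at hx
    · intro h
      obtain ⟨v, hv⟩ := DFunLike.ne_iff.1 h
      rcases lt_or_gt_of_ne hv with hv | hv
      · exact ⟨-v, by simpa using hv⟩
      · exact ⟨v, hv⟩
  | insert n s hn ih =>
    by_cases hg : g n = 0
    · have hmem : n ∈ insert n s := Finset.mem_insert_self n s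
      congr 1
      ext T
      refine and_congr_right fun _ => iff_of_false ?_ fun h => h.2 n hmem (by simp [hg])
      rintro ⟨x, hx⟩
      by_cases hT : n ∈ T
      · simpa [hg] using (hx.2 n hmem).1 hT
      · simpa [hg] using (hx.2 n hmem).2 hT
    · rw [ncard_cells_insert (fun h => (hn n h).false) hg, ncard_nbc_insert hn hg, ih, ih]

theorem IsNBC.linearIndepOn {ι W : Type*} [LinearOrder ι] [AddCommGroup W] [Module ℝ W]
    {ℓ : Dual ℝ W} {g : ι → Dual ℝ W} {s I : Finset ι} (hI : IsNBC ℓ g s I) (hIs : I ⊆ s) :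
    LinearIndepOn ℝ g (I : Set ι) := by
  suffices ∀ K ⊆ I, LinearIndepOn ℝ g (K : Set ι) from this I subset_rfl
  intro K
  induction K using Finset.induction_on_min with
  | empty => simp
  | insert i K hiK ih =>
    intro hK
    rw [Finset.coe_insert, linearIndepOn_insert fun hi => (hiK i hi).false]
    refine ⟨ih fun k hk => hK (Finset.mem_insert_of_mem hk), fun hmem => ?_⟩
    have hsub : (K : Set ι) ⊆ {j | j ∈ I ∧ i < j} := fun k hk =>
      ⟨hK (Finset.mem_insert_of_mem hk), hiK k hk⟩
    exact hI.2 i (hIs (hK (Finset.mem_insert_self i K))) (span_mono (Set.image_mono hsub) hmem)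

/-- The linear functional on `V × ℝ` whose restriction to height `1` is `h i - a i`. -/
def homogenize {ι V : Type*} [AddCommGroup V] [Module ℝ V] (h : ι → Dual ℝ V) (a : ι → ℝ)
    (i : ι) : Dual ℝ (V × ℝ) :=
  (h i).comp (LinearMap.fst ℝ V ℝ) - a i • LinearMap.snd ℝ V ℝ

@[simp]
theorem homogenize_apply {ι V : Type*} [AddCommGroup V] [Module ℝ V] (h : ι → Dual ℝ V)
    (a : ι → ℝ) (i : ι) (x : V × ℝ) : homogenize h a i x = h i x.1 - a i * x.2 :=
  rfl

theorem exists_inCell_homogenize_iff {ι V : Type*} [AddCommGroup V] [Module ℝ V]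
    {h : ι → Dual ℝ V} {a : ι → ℝ} {s T : Finset ι} :
    (∃ x, InCell (LinearMap.snd ℝ V ℝ) (homogenize h a) s T x) ↔
      ∃ x, InCell (LinearMap.snd ℝ V ℝ) (homogenize h a) s T (x, 1) := by
  refine ⟨fun ⟨⟨x, t⟩, ht, hx⟩ => ⟨t⁻¹ • x, by simp, fun i hi => ?_⟩, fun ⟨x, hx⟩ => ⟨_, hx⟩⟩
  replace ht : 0 < t := ht
  have h1 : homogenize h a i (t⁻¹ • x, 1) = t⁻¹ * homogenize h a i (x, t) := by
    simp
    field_simp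
  rw [h1]
  exact ⟨fun hT => mul_pos (inv_pos.2 ht) ((hx i hi).1 hT),
    fun hT => mul_neg_of_pos_of_neg (inv_pos.2 ht) ((hx i hi).2 hT)⟩

theorem numRegions_eq_ncard_cells {ι V : Type*} [Fintype ι] [AddCommGroup V] [Module ℝ V]
    [TopologicalSpace V] [ContinuousAdd V] [ContinuousSMul ℝ V] (h : ι → Dual ℝ V)
    (hc : ∀ i, Continuous (h i)) (a : ι → ℝ) :
    numRegions {x : V | ∀ i, h i x ≠ a i} =
      {T | T ⊆ Finset.univ ∧ ∃ x,
        InCell (LinearMap.snd ℝ V ℝ) (homogenize h a) Finset.univ T x}.ncard := by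
  classical
  let X := {x : V | ∀ i, h i x ≠ a i}
  let f : X → ι → Bool := fun x i => decide (a i < h i x)
  have hf : Continuous f := by
    refine continuous_pi fun i => (IsLocallyConstant.iff_continuous _).1 ?_
    refine (IsLocallyConstant.iff_eventually_eq _).2 fun x => ?_
    have hcx : ContinuousAt (fun y : X => h i y) x :=
      ((hc i).comp continuous_subtype_val).continuousAt
    rcases lt_or_gt_of_ne (x.2 i) with hx | hx
    · filter_upwards [hcx.eventually (gt_mem_nhds hx)] with y hy
      simp [f, hx.not_gt, hy.not_gt]
    · filter_upwards [hcx.eventually (lt_mem_nhds hx)] with y hy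
      simp [f, hx, hy]
  have hinj : Function.Injective hf.connectedComponentsLift := by
    intro p q
    obtain ⟨x, rfl⟩ := ConnectedComponents.surjective_coe p
    obtain ⟨y, rfl⟩ := ConnectedComponents.surjective_coe q
    simp only [Continuous.connectedComponentsLift_apply_coe]
    intro hxy
    have hside (i) : a i < h i x ↔ a i < h i y := by simpa [f] using congrFun hxy i
    have hseg : segment ℝ (y : V) x ⊆ X := by
      intro z hz i
      rcases lt_or_gt_of_ne (y.2 i) with hy | hy
      · have hx : h i x < a i :=
          lt_of_le_of_ne (not_lt.1 fun h => hy.not_gt ((hside i).1 h)) (x.2 i)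
        exact ((convex_halfSpace_lt (h i).isLinear (a i)).segment_subset hy hx hz).ne
      · exact ((convex_halfSpace_gt (h i).isLinear (a i)).segment_subset hy
          ((hside i).2 hy) hz).ne'
    rw [ConnectedComponents.coe_eq_coe']
    have hpre : IsPreconnected ((↑) ⁻¹' segment ℝ (y : V) x : Set X) := by
      rw [← Topology.IsInducing.subtypeVal.isPreconnected_image,
        Set.image_preimage_eq_of_subset (by simpa using hseg)]
      exact (convex_segment _ _).isPreconnected
    exact hpre.subset_connectedComponent (left_mem_segment ℝ (y : V) x)
      (right_mem_segment ℝ (y : V) x)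
  have hrange : Set.range hf.connectedComponentsLift = Set.range f := by
    rw [← ConnectedComponents.surjective_coe.range_comp]
    rfl
  have hcells : {T | T ⊆ Finset.univ ∧ ∃ x,
      InCell (LinearMap.snd ℝ V ℝ) (homogenize h a) Finset.univ T x} =
      (fun b : ι → Bool => Finset.univ.filter fun i => b i = true) '' Set.range f := by
    ext T
    simp only [Finset.subset_univ, true_and, exists_inCell_homogenize_iff]
    constructor
    · rintro ⟨x, -, hx⟩
      simp only [Finset.mem_univ, true_imp_iff, homogenize_apply, mul_one, sub_pos,
        sub_neg] at hx
      refine ⟨_, ⟨⟨x, fun i => ?_⟩, rfl⟩, ?_⟩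
      · by_cases hi : i ∈ T
        · exact ((hx i).1 hi).ne'
        · exact ((hx i).2 hi).ne
      · ext i
        by_cases hi : i ∈ T
        · simpa [f, hi] using (hx i).1 hi
        · simpa [f, hi] using ((hx i).2 hi).le
    · rintro ⟨_, ⟨x, rfl⟩, rfl⟩
      refine ⟨x, by simp, fun i _ => ?_⟩
      have := x.2 i
      simp only [f, Finset.mem_filter, Finset.mem_univ, true_and, decide_eq_true_eq,
        homogenize_apply, mul_one, sub_pos, sub_neg, imp_self, not_lt]
      exact fun h => lt_of_le_of_ne h this
  rw [numRegions, ← Nat.card_range_of_injective hinj, hrange, hcells, Set.InjOn.ncard_image,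
    Nat.card_coe_set_eq]
  intro b _ b' _ hb
  ext i
  have := congrArg (i ∈ ·) hb
  simpa using this

section Circuits

variable {d N : ℕ} {h : Fin N → ((Fin d → ℝ) →ₗ[ℝ] ℝ)} {a : Fin N → ℝ} {I J : Finset (Fin N)}

theorem linearIndepOn_iff_rk : LinearIndepOn ℝ h (I : Set (Fin N)) ↔ rk h I = I.card := by
  rw [LinearIndepOn, linearIndependent_iff_card_eq_finrank_span, Set.finrank, rk,
    ← Set.image_eq_range, eq_comm]
  simp

theorem homogenize_dualMap_inl (i : Fin N) :
    (LinearMap.inl ℝ (Fin d → ℝ) ℝ).dualMap (homogenize h a i) = h i := by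
  ext
  simp

theorem snd_notMem_span_homogenize (hI : LinearIndepOn ℝ h (I : Set (Fin N))) :
    LinearMap.snd ℝ (Fin d → ℝ) ℝ ∉ span ℝ (homogenize h a '' (I : Set (Fin N))) := by
  intro hmem
  obtain ⟨c, hc⟩ := (mem_span_image_finset_iff_exists_fun' ℝ).1 hmem
  have h0 : ∑ i ∈ I, c i • h i = 0 := by
    have := congrArg (LinearMap.inl ℝ (Fin d → ℝ) ℝ).dualMap hc
    simp only [map_sum, map_smul, homogenize_dualMap_inl] at this
    rw [this]
    ext
    simp
  have hc0 := linearIndepOn_finset_iff.1 hI c h0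
  rw [Finset.sum_eq_zero fun i hi => by rw [hc0 i hi, zero_smul]] at hc
  simpa using LinearMap.congr_fun hc (0, 1)

theorem isCentral_of_linearIndepOn (hI : LinearIndepOn ℝ h (I : Set (Fin N))) :
    IsCentral h a I := by
  by_contra hcon
  apply snd_notMem_span_homogenize (a := a) hI
  rw [Set.image_eq_range]
  refine mem_span_of_iInf_ker_le_ker fun x hx => ?_
  by_contra ht
  refine hcon ⟨x.2⁻¹ • x.1, Set.mem_iInter₂.2 fun i hi => ?_⟩
  have hi0 : h i x.1 - a i * x.2 = 0 := (Submodule.mem_iInf _).1 hx ⟨i, hi⟩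
  replace ht : x.2 ≠ 0 := ht
  simp only [Set.mem_ofPred_eq, map_smul, smul_eq_mul]
  field_simp
  linarith

theorem isCentralCycle_insert_of_sum_eq {i : Fin N} (hi : i ∉ J)
    (hJ : LinearIndepOn ℝ h (J : Set (Fin N))) {c : Fin N → ℝ} (hc : ∀ j ∈ J, c j ≠ 0)
    (hsum : ∑ j ∈ J, c j • homogenize h a j = homogenize h a i) :
    IsCentralCycle h a (insert i J) := by
  have hsum' : ∑ j ∈ J, c j • h j = h i := by
    simpa only [map_sum, map_smul, homogenize_dualMap_inl] using
      congrArg (LinearMap.inl ℝ (Fin d → ℝ) ℝ).dualMap hsum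
  have hspan : h i ∈ span ℝ (h '' (J : Set (Fin N))) :=
    (mem_span_image_finset_iff_exists_fun' ℝ).2 ⟨c, hsum'⟩
  refine ⟨?_, fun K hK => ?_, ?_⟩
  · have : rk h (insert i J) = rk h J := by
      rw [rk, rk, Finset.coe_insert, Set.image_insert_eq, span_insert_eq_span hspan]
    rw [this, linearIndepOn_iff_rk.1 hJ, Finset.card_insert_of_notMem hi]
    simp
  · rw [← linearIndepOn_iff_rk]
    by_cases hiK : i ∈ K
    · obtain ⟨j, hj, hjK⟩ := Finset.exists_of_ssubset hK
      have hji : j ≠ i := by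
        rintro rfl
        exact hjK hiK
      replace hj : j ∈ J := (Finset.mem_insert.1 hj).resolve_left hji
      have hsub : K.erase i ⊆ J.erase j := by
        intro k hk
        have hk' := Finset.mem_erase.1 hk
        refine Finset.mem_erase.2 ⟨?_, (Finset.mem_insert.1 (hK.1 hk'.2)).resolve_left hk'.1⟩
        rintro rfl
        exact hjK hk'.2
      rw [← Finset.insert_erase hiK, Finset.coe_insert, linearIndepOn_insert (by simp)]
      refine ⟨hJ.mono fun k hk => Finset.mem_of_mem_erase (hsub hk), fun hmem => ?_⟩
      have hmem' : h i ∈ span ℝ (h '' ((J.erase j : Finset (Fin N)) : Set (Fin N))) :=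
        span_mono (Set.image_mono (by exact_mod_cast hsub)) hmem
      rw [← hsum', ← Finset.add_sum_erase J _ hj, Submodule.add_mem_iff_left _
        (sum_mem fun k hk => smul_mem _ _ (subset_span (Set.mem_image_of_mem h hk))),
        smul_mem_iff _ (hc j hj), Finset.coe_erase] at hmem'
      exact linearIndepOn_iff_notMem_span.1 hJ j hj hmem'
    · exact linearIndepOn_iff_rk.2 (linearIndepOn_iff_rk.1 (hJ.mono fun k hk =>
        (Finset.mem_insert.1 (hK.1 hk)).resolve_left (by rintro rfl; exact hiK hk)))
  · obtain ⟨x, hx⟩ := isCentral_of_linearIndepOn (a := a) hJ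
    have hxJ (j) (hj : j ∈ J) : h j x = a j := Set.mem_iInter₂.1 hx j hj
    refine ⟨x, Set.mem_iInter₂.2 fun j hj => ?_⟩
    rcases Finset.mem_insert.1 hj with rfl | hj
    · have hx0 := LinearMap.congr_fun hsum (x, 1)
      simp only [LinearMap.sum_apply, LinearMap.smul_apply, homogenize_apply, mul_one] at hx0
      rw [Finset.sum_eq_zero fun k hk => by rw [hxJ k hk, sub_self, smul_zero]] at hx0
      exact sub_eq_zero.1 hx0.symm
    · exact hxJ j hj

theorem homogenize_mem_span_of_isCentralCycle {i : Fin N} (hi : i ∉ J)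
    (hC : IsCentralCycle h a (insert i J)) :
    homogenize h a i ∈ span ℝ (homogenize h a '' (J : Set (Fin N))) := by
  obtain ⟨hrk, hprop, x, hx⟩ := hC
  have hJ : LinearIndepOn ℝ h (J : Set (Fin N)) :=
    linearIndepOn_iff_rk.2 (hprop J (Finset.ssubset_insert hi))
  have hspan : h i ∈ span ℝ (h '' (J : Set (Fin N))) := by
    by_contra hcon
    have := linearIndepOn_iff_rk.1
      (by simpa using (linearIndepOn_insert (by simpa using hi)).2 ⟨hJ, hcon⟩ :
        LinearIndepOn ℝ h ((insert i J : Finset (Fin N)) : Set (Fin N)))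
    omega
  have hxi (j) (hj : j ∈ insert i J) : h j x = a j := Set.mem_iInter₂.1 hx j hj
  obtain ⟨c, hc⟩ := (mem_span_image_finset_iff_exists_fun' ℝ).1 hspan
  have hca : ∑ j ∈ J, c j * a j = a i := by
    rw [← hxi i (Finset.mem_insert_self i J), ← hc, LinearMap.sum_apply]
    exact Finset.sum_congr rfl fun j hj => by
      rw [LinearMap.smul_apply, hxi j (Finset.mem_insert_of_mem hj), smul_eq_mul]
  refine (mem_span_image_finset_iff_exists_fun' ℝ).2 ⟨c, LinearMap.ext fun y => ?_⟩
  simp only [LinearMap.sum_apply, LinearMap.smul_apply, homogenize_apply, smul_eq_mul, mul_sub,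
    Finset.sum_sub_distrib, ← mul_assoc, ← Finset.sum_mul, hca, ← hc]

theorem linearIndepOn_of_homogenize (hg : LinearIndepOn ℝ (homogenize h a) (I : Set (Fin N)))
    (hsnd : LinearMap.snd ℝ (Fin d → ℝ) ℝ ∉ span ℝ (homogenize h a '' (I : Set (Fin N)))) :
    LinearIndepOn ℝ h (I : Set (Fin N)) := by
  refine linearIndepOn_finset_iff.2 fun c hc => linearIndepOn_finset_iff.1 hg c ?_
  set φ := ∑ i ∈ I, c i • homogenize h a i with hφ
  have hmem : φ ∈ span ℝ (homogenize h a '' (I : Set (Fin N))) :=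
    (mem_span_image_finset_iff_exists_fun' ℝ).2 ⟨c, rfl⟩
  have hker : φ ∘ₗ LinearMap.inl ℝ (Fin d → ℝ) ℝ = 0 := by
    have : (LinearMap.inl ℝ (Fin d → ℝ) ℝ).dualMap φ = 0 := by
      simpa only [hφ, map_sum, map_smul, homogenize_dualMap_inl] using hc
    exact this
  have hsmul : φ = φ (0, 1) • LinearMap.snd ℝ (Fin d → ℝ) ℝ := by
    refine LinearMap.prod_ext ?_ ?_
    · rw [hker]
      ext
      simp
    · ext
      simp
  by_contra h0
  rw [hsmul] at hmem
  exact hsnd ((smul_mem_iff _ fun hz => h0 (by rw [hsmul, hz, zero_smul])).1 hmem)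

theorem isNBC_iff (ρ : LinearOrder (Fin N)) :
    IsNBC (LinearMap.snd ℝ (Fin d → ℝ) ℝ) (homogenize h a) Finset.univ I ↔
      rk h I = I.card ∧ ∀ J ⊆ I, ¬ IsBrokenCentralCircuit h a ρ J := by
  constructor
  · intro hI
    refine ⟨linearIndepOn_iff_rk.1 (linearIndepOn_of_homogenize
      (hI.linearIndepOn (Finset.subset_univ I)) hI.1), ?_⟩
    rintro J hJ ⟨i, hi, hC, hmin⟩
    refine hI.2 i (Finset.mem_univ i) (span_mono (Set.image_mono fun j hj => ?_)
      (homogenize_mem_span_of_isCentralCycle hi hC))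
    exact ⟨hJ hj, @lt_of_le_of_ne _ ρ.toPartialOrder _ _ (hmin j (Finset.mem_insert_of_mem hj))
      (ne_of_mem_of_not_mem hj hi).symm⟩
  · rintro ⟨hI, hJ⟩
    rw [← linearIndepOn_iff_rk] at hI
    refine ⟨snd_notMem_span_homogenize hI, fun i _ hmem => ?_⟩
    classical
    rw [show {j | j ∈ I ∧ ρ.lt i j} = ((I.filter fun j => ρ.lt i j : Finset (Fin N)) :
      Set (Fin N)) by ext j; simp] at hmem
    obtain ⟨c, hc⟩ := (mem_span_image_finset_iff_exists_fun' ℝ).1 hmem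
    let J := (I.filter fun j => ρ.lt i j).filter fun j => c j ≠ 0
    have hJI : J ⊆ I := (Finset.filter_subset _ _).trans (Finset.filter_subset _ _)
    have hlt (j) (hj : j ∈ J) : ρ.lt i j := (Finset.mem_filter.1 (Finset.mem_filter.1 hj).1).2
    have hiJ : i ∉ J := fun hi => @lt_irrefl _ ρ.toPreorder i (hlt i hi)
    refine hJ J hJI ⟨i, hiJ, isCentralCycle_insert_of_sum_eq (c := c) hiJ (hI.mono hJI)
      (fun j hj => (Finset.mem_filter.1 hj).2) ?_, fun j hj => ?_⟩
    · rw [← hc]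
      refine Finset.sum_subset (Finset.filter_subset _ _) fun j hj hjJ => ?_
      have : c j = 0 := by
        by_contra h0
        exact hjJ (Finset.mem_filter.2 ⟨hj, h0⟩)
      rw [this, zero_smul]
    · rcases Finset.mem_insert.1 hj with rfl | hj
      · exact ρ.le_refl _
      · exact @le_of_lt _ ρ.toPreorder _ _ (hlt j hj)

end Circuits

/-- The NBC theorem: the number of regions equals the number of independent subsets
containing no broken central circuit. -/
theorem stmt1 (d N : ℕ) (h : Fin N → ((Fin d → ℝ) →ₗ[ℝ] ℝ)) (hne : ∀ i, h i ≠ 0)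
    (a : Fin N → ℝ) (ρ : LinearOrder (Fin N)) :
    numRegions {x : Fin d → ℝ | ∀ i, h i x ≠ a i} =
      Nat.card {I : Finset (Fin N) //
        rk h I = I.card ∧ ∀ J ⊆ I, ¬ IsBrokenCentralCircuit h a ρ J} := by
  rw [numRegions_eq_ncard_cells h (fun i => (h i).continuous_of_finiteDimensional) a,
    @ncard_cells_eq_ncard_nbc _ ρ]
  simp only [Finset.subset_univ, true_and, isNBC_iff ρ]
  rfl
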